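/- Let w : ℕ → Σ₃ be an infinite word that contains no factor of exponent 5/2 or greater and whose factor complexity equals 2n+1 for every n ≥ 0. If w contains none of the words 11, 12, 21, 22, 001, 10201 as a factor, then L(w)^R ⊇ L(h₁^R(G)), where h₁ is the morphism h₁ = [0200201, 00201, 00200201]. -/

import Mathlib

/-! Common definitions: the alphabet Σ₃, finite and infinite words, factors,
factor complexity, periods and exponents, morphisms, the morphism γ and its
fixed point G = γ^ω(0). -/

abbrev Sigma3 := Fin 3
abbrev Word := List Sigma3
abbrev InfWord := ℕ → Sigma3

/-- `u` is a factor of the infinite word `w`. -/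
def IsFactor (u : Word) (w : InfWord) : Prop :=
  ∃ i : ℕ, u = (List.range u.length).map (fun j => w (i + j))

/-- The set of finite factors of `w`. -/
def Lang (w : InfWord) : Set Word := {u | IsFactor u w}

/-- Factor complexity: the number of distinct length-`n` factors of `w`. -/
noncomputable def complexity (w : InfWord) (n : ℕ) : ℕ :=
  Set.ncard {u : Word | IsFactor u w ∧ u.length = n}

/-- `v` has period `p` (with `p ≥ 1`). -/
def HasPeriod (v : Word) (p : ℕ) : Prop :=
  1 ≤ p ∧ ∀ i, i + p < v.length → v.getD i 0 = v.getD (i + p) 0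

/-- The least period of `v`. -/
noncomputable def minPeriod (v : Word) : ℕ := sInf {p | HasPeriod v p}

/-- The exponent `|v| / p` of a nonempty finite word `v`, where `p` is its least period. -/
noncomputable def expo (v : Word) : ℝ := (v.length : ℝ) / (minPeriod v : ℝ)

/-- `w` contains no factor of exponent `5/2` or greater. -/
def NoFiveHalves (w : InfWord) : Prop :=
  ∀ u : Word, u ≠ [] → IsFactor u w → expo u < 5 / 2

/-- Apply a morphism (given by the images of the three letters) to a finite word. -/
def applyM (f : Sigma3 → Word) (u : Word) : Word := (u.map f).flatten

/-- The image under `f` of the length-`k` prefix of the infinite word `u`. -/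
def imPrefix (f : Sigma3 → Word) (u : InfWord) (k : ℕ) : Word :=
  applyM f ((List.range k).map u)

/-- The image of an infinite word under a (non-erasing) morphism. -/
def applyMInf (f : Sigma3 → Word) (u : InfWord) : InfWord :=
  fun n => (imPrefix f u (n + 1)).getD n 0

/-- The morphism `γ = [01, 2, 02]`. -/
def gam : Sigma3 → Word := ![[0, 1], [2], [0, 2]]

/-- The fixed point `G = γ^ω(0)` of `γ`, the unique infinite fixed point beginning with 0. -/
def G : InfWord := fun n => ((applyM gam)^[n + 1] [0]).getD n 0

/-- The final segment of `w` starting at position `k`. -/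
def shift (w : InfWord) (k : ℕ) : InfWord := fun i => w (i + k)

/-- The reverse `h^R` of a morphism `h`. -/
def mR (f : Sigma3 → Word) : Sigma3 → Word := fun x => (f x).reverse

/-- The finite word `u` occurs in the infinite word `w` at position `k`. -/
def OccursAt (u : Word) (w : InfWord) (k : ℕ) : Prop :=
  ∀ i (h : i < u.length), u[i] = w (k + i)

theorem OccursAt.isFactor {u : Word} {w : InfWord} {k : ℕ} (h : OccursAt u w k) :
    IsFactor u w := by
  refine ⟨k, List.ext_getElem (by simp) fun i h₁ h₂ => ?_⟩
  simpa using h i h₁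

theorem occursAt_append {u v : Word} {w : InfWord} {k : ℕ} :
    OccursAt (u ++ v) w k ↔ OccursAt u w k ∧ OccursAt v w (k + u.length) := by
  constructor
  · intro h
    refine ⟨fun i hi => ?_, fun i hi => ?_⟩
    · rw [← h i (by simp; omega), List.getElem_append_left hi]
    · have := h (u.length + i) (by simp; omega)
      rw [List.getElem_append_right (by omega)] at this
      simpa [Nat.add_assoc] using this
  · rintro ⟨h₁, h₂⟩ i hi
    rw [List.length_append] at hi
    by_cases hu : i < u.length
    · rw [List.getElem_append_left hu, h₁ i hu]
    · rw [List.getElem_append_right (by omega), h₂ _ (by omega)]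
      congr 1
      omega

theorem OccursAt.middle {s u t : Word} {w : InfWord} {k : ℕ} (h : OccursAt (s ++ u ++ t) w k) :
    OccursAt u w (k + s.length) :=
  (occursAt_append.1 (occursAt_append.1 h).1).2

theorem IsFactor.of_append {s u t : Word} {w : InfWord} (h : IsFactor (s ++ u ++ t) w) :
    IsFactor u w := by
  obtain ⟨k, hk⟩ := h
  have hocc : OccursAt (s ++ u ++ t) w k := fun i hi => by
    rw [List.getElem_of_eq hk hi]
    simp
  exact hocc.middle.isFactor

theorem applyM_append (f : Sigma3 → Word) (u v : Word) :
    applyM f (u ++ v) = applyM f u ++ applyM f v := by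
  simp [applyM]

theorem applyM_applyM (f g : Sigma3 → Word) (u : Word) :
    applyM f (applyM g u) = applyM (fun x => applyM f (g x)) u := by
  induction u with
  | nil => rfl
  | cons a u ih =>
    have h : a :: u = [a] ++ u := rfl
    rw [h, applyM_append, applyM_append, applyM_append, ih]
    simp [applyM]

theorem applyM_range_succ (f : Sigma3 → Word) (v : InfWord) (n : ℕ) :
    applyM f ((List.range (n + 1)).map v) = applyM f ((List.range n).map v) ++ f (v n) := by
  simp [applyM, List.range_succ]

theorem reverse_applyM (f : Sigma3 → Word) (u : Word) :
    (applyM f u).reverse = applyM (mR f) u.reverse := by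
  induction u with
  | nil => rfl
  | cons a u ih =>
    have h : a :: u = [a] ++ u := rfl
    rw [h, applyM_append, List.reverse_append, List.reverse_append, applyM_append, ih]
    simp [applyM, mR]

theorem mR_mR (f : Sigma3 → Word) : mR (mR f) = f :=
  funext fun x => List.reverse_reverse (f x)

theorem length_le_length_applyM {f : Sigma3 → Word} (hf : ∀ x, f x ≠ []) (u : Word) :
    u.length ≤ (applyM f u).length := by
  induction u with
  | nil => simp
  | cons a u ih =>
    have h : a :: u = [a] ++ u := rfl
    have ha := List.length_pos_iff.2 (hf a)
    rw [h, applyM_append, List.length_append, List.length_append]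
    simp only [applyM, List.map_cons, List.map_nil, List.flatten_cons, List.flatten_nil,
      List.append_nil, List.length_singleton] at ih ⊢
    omega

/-- `w` has a suffix, starting at position `k`, that is the `f`-image of `v`. -/
def IsImageFrom (f : Sigma3 → Word) (v w : InfWord) (k : ℕ) : Prop :=
  ∀ n, OccursAt (applyM f ((List.range n).map v)) w k

theorem IsImageFrom.shift {f : Sigma3 → Word} {v w : InfWord} {k : ℕ}
    (h : IsImageFrom f v w k) (m : ℕ) : ∃ k', IsImageFrom f (shift v m) w k' := by
  refine ⟨k + (applyM f ((List.range m).map v)).length, fun n => ?_⟩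
  have hn := h (m + n)
  rw [List.range_add, List.map_append, applyM_append, occursAt_append] at hn
  have he : (List.map (fun x => m + x) (List.range n)).map v
      = (List.range n).map (_root_.shift v m) := by
    rw [List.map_map]
    refine List.map_congr_left fun i _ => ?_
    simp [_root_.shift, Nat.add_comm]
  rw [← he]
  exact hn.2

theorem IsImageFrom.comp {f g : Sigma3 → Word} {v' v w : InfWord} {k m : ℕ}
    (h : IsImageFrom f v w k) (h' : IsImageFrom g v' v m) :
    ∃ k', IsImageFrom (fun x => applyM f (g x)) v' w k' := by
  obtain ⟨k', hk'⟩ := h.shift m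
  refine ⟨k', fun n => ?_⟩
  have hn := hk' (applyM g ((List.range n).map v')).length
  have he : (List.range (applyM g ((List.range n).map v')).length).map (_root_.shift v m)
      = applyM g ((List.range n).map v') := by
    refine List.ext_getElem (by simp) fun i h₁ h₂ => ?_
    rw [h' n i h₂]
    simp [_root_.shift, Nat.add_comm]
  rwa [he, applyM_applyM] at hn

theorem exists_isImageFrom {f : Sigma3 → Word} {w : InfWord} (C : ℕ → Prop)
    (hC : ∀ k, C k → ∃ x, OccursAt (f x) w k ∧ C (k + (f x).length)) {k : ℕ} (hk : C k) :
    ∃ v, IsImageFrom f v w k := by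
  choose x hx hx' using fun k : {k // C k} => hC k k.2
  let cut : ℕ → {k // C k} := fun n =>
    Nat.rec ⟨k, hk⟩ (fun _ c => ⟨c + (f (x c)).length, hx' c⟩) n
  have hcut : ∀ n, OccursAt (applyM f ((List.range n).map fun i => x (cut i))) w k ∧
      (cut n).1 = k + (applyM f ((List.range n).map fun i => x (cut i))).length := by
    intro n
    induction n with
    | zero => exact ⟨fun i hi => absurd hi (by simp [applyM]), by simp [applyM, cut]⟩
    | succ n ih =>
      rw [applyM_range_succ]
      refine ⟨occursAt_append.2 ⟨ih.1, ?_⟩, ?_⟩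
      · rw [← ih.2]
        exact hx (cut n)
      · rw [List.length_append, ← Nat.add_assoc, ← ih.2]
  exact ⟨_, fun n => (hcut n).1⟩

theorem NoFiveHalves.not_periodic {w : InfWord} (hp : NoFiveHalves w) {k p n : ℕ} (hpos : 1 ≤ p)
    (hn : 5 * p ≤ 2 * n) (h : ∀ i, i + p < n → w (k + i) = w (k + (i + p))) : False := by
  set u : Word := (List.range n).map fun j => w (k + j) with hu
  have hlen : u.length = n := by simp [hu]
  have hper : HasPeriod u p := by
    refine ⟨hpos, fun i hi => ?_⟩
    rw [hlen] at hi
    rw [List.getD_eq_getElem _ _ (by omega), List.getD_eq_getElem _ _ (by omega)]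
    simpa [hu] using h i hi
  have hmem : HasPeriod u (minPeriod u) :=
    Nat.sInf_mem (s := {p | HasPeriod u p}) ⟨p, hper⟩
  have hle : minPeriod u ≤ p := Nat.sInf_le hper
  have hlt := hp u (List.length_pos_iff.1 (by omega)) ⟨k, by rw [hlen]⟩
  have h1 : (0 : ℝ) < minPeriod u := by exact_mod_cast hmem.1
  rw [expo, hlen, div_lt_iff₀ h1] at hlt
  have h2 : (minPeriod u : ℝ) ≤ p := by exact_mod_cast hle
  have h3 : (5 : ℝ) * p ≤ 2 * n := by exact_mod_cast hn
  linarith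

theorem NoFiveHalves.not_occursAt {w : InfWord} (hp : NoFiveHalves w) {z u : Word} {k : ℕ}
    (hz : z ≠ []) (hu : u <+: z ++ u) (hlen : 5 * z.length ≤ 2 * u.length) :
    ¬ OccursAt u w k := by
  intro h
  refine hp.not_periodic (k := k) (List.length_pos_iff.2 hz) hlen fun i hi => ?_
  rw [← h i (by omega), ← h (i + z.length) hi, hu.getElem hi,
    List.getElem_append_right (by omega)]
  simp

theorem NoFiveHalves.not_occursAt_append {w : InfWord} (hp : NoFiveHalves w) {s y u : Word}
    {k : ℕ} (hy : y ≠ []) (hs : s <:+ y) (hu : u <+: y ++ u)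
    (hlen : 5 * y.length ≤ 2 * (s.length + u.length)) : ¬ OccursAt (s ++ u) w k := by
  obtain ⟨t, rfl⟩ := hs
  refine hp.not_occursAt (z := s ++ t) ?_ ?_ ?_
  · simpa [and_comm] using hy
  · simpa [List.append_assoc] using hu
  · simp only [List.length_append] at hlen ⊢
    omega

/-- Common prefixes `p`, `q` and common suffixes `s`, `t` of the images of `f`, long enough for
the `f`-image of a letter square, or of `12`, to extend to a repetition of exponent `5/2`. -/
structure LongOverlaps (f : Sigma3 → Word) (p q s t : Word) : Prop where
  ne_nil : ∀ x, f x ≠ []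
  prefix_p : ∀ x, p <+: f x
  q_prefix_two : q <+: f 2
  q_prefix_one_zero : q <+: f 1 ++ f 0
  q_prefix_one : q <+: f 1 ++ q
  s_suffix : ∀ x, s <:+ f x
  t_suffix_zero : t <:+ f 0
  t_suffix_two : t <:+ f 2
  zero_le_two : (f 0).length ≤ (f 2).length
  one_le_two : (f 1).length ≤ (f 2).length
  two_le_sp : (f 2).length ≤ 2 * (s.length + p.length)
  one_le_sq : 3 * (f 1).length ≤ 2 * (s.length + q.length)
  zero_two_le_tq : (f 0).length + (f 2).length ≤ 2 * (t.length + q.length)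
  two_le_tp : (f 2).length ≤ 2 * (t.length + p.length)
  two_le_zero_sq : (f 2).length ≤ (f 0).length + 2 * (s.length + q.length)

theorem LongOverlaps.comp {f : Sigma3 → Word} {p q s t : Word} (h : LongOverlaps f p q s t) :
    LongOverlaps (fun x => applyM f (mR gam x)) q (f 2 ++ p) t (s ++ f 0) := by
  have e0 : applyM f (mR gam 0) = f 1 ++ f 0 := by simp [applyM, mR, gam]
  have e1 : applyM f (mR gam 1) = f 2 := by simp [applyM, mR, gam]
  have e2 : applyM f (mR gam 2) = f 2 ++ f 0 := by simp [applyM, mR, gam]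
  have l0 := List.length_pos_iff.2 (h.ne_nil 0)
  have l1 := h.zero_le_two
  have l2 := h.one_le_two
  have l3 := h.two_le_sp
  have l4 := h.one_le_sq
  have l5 := h.zero_two_le_tq
  have l6 := h.two_le_tp
  have l7 := h.two_le_zero_sq
  constructor
  case ne_nil =>
    intro x
    fin_cases x
    · simpa [e0] using fun _ => h.ne_nil 0
    · simpa [e1] using h.ne_nil 2
    · simpa [e2] using fun _ => h.ne_nil 0
  case prefix_p =>
    intro x
    fin_cases x
    · simpa [e0] using h.q_prefix_one_zero
    · simpa [e1] using h.q_prefix_two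
    · simpa [e2] using h.q_prefix_two.trans (List.prefix_append _ _)
  case q_prefix_two => simpa [e2] using h.prefix_p 0
  case q_prefix_one_zero =>
    simpa [e0, e1] using (h.prefix_p 1).trans (List.prefix_append _ _)
  case q_prefix_one =>
    simpa [e1] using (h.prefix_p 2).trans (List.prefix_append _ _)
  case s_suffix =>
    intro x
    fin_cases x
    · simpa [e0] using h.t_suffix_zero.trans (List.suffix_append _ _)
    · simpa [e1] using h.t_suffix_two
    · simpa [e2] using h.t_suffix_zero.trans (List.suffix_append _ _)
  case t_suffix_zero => simpa [e0, List.suffix_append_self_iff] using h.s_suffix 1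
  case t_suffix_two => simpa [e2, List.suffix_append_self_iff] using h.s_suffix 2
  all_goals
    simp only [e0, e1, e2, List.length_append]
    omega

section LetterPairs

variable {f : Sigma3 → Word} {p q s t : Word} {v w : InfWord} {k : ℕ}

theorem LongOverlaps.not_square (h : LongOverlaps f p q s t) (hp : NoFiveHalves w)
    (hv : IsImageFrom f v w k) (j : ℕ) : v (j + 1) ≠ v (j + 2) := by
  intro he
  obtain ⟨k', hk'⟩ := hv.shift j
  obtain ⟨a, ha⟩ := h.s_suffix (v j)
  obtain ⟨b, hb⟩ := h.prefix_p (v (j + 3))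
  have hocc := hk' 4
  have e : applyM f ((List.range 4).map (shift v j))
      = a ++ (s ++ (f (v (j + 1)) ++ f (v (j + 1)) ++ p)) ++ b := by
    have : applyM f ((List.range 4).map (shift v j))
        = f (v j) ++ (f (v (j + 1)) ++ (f (v (j + 2)) ++ f (v (j + 3)))) := by
      simp [applyM, shift, List.range_succ, Nat.add_comm]
    rw [this, ← he, ← ha, ← hb]
    simp
  rw [e] at hocc
  refine hp.not_occursAt_append (h.ne_nil (v (j + 1))) (h.s_suffix _) ?_ ?_ hocc.middle
  · simpa [List.append_assoc] using (h.prefix_p (v (j + 1))).trans (List.prefix_append _ _)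
  · have h1 := h.two_le_sp
    have h2 := h.zero_le_two
    have h3 := h.one_le_two
    have h4 : (f (v (j + 1))).length ≤ (f 2).length := by
      generalize v (j + 1) = x
      fin_cases x
      exacts [h2, h3, le_rfl]
    simp only [List.length_append]
    omega

theorem LongOverlaps.not_one_two (h : LongOverlaps f p q s t) (hp : NoFiveHalves w)
    (hv : IsImageFrom f v w k) (j : ℕ) (h1 : v (j + 1) = 1) : v (j + 2) ≠ 2 := by
  intro h2
  obtain ⟨k', hk'⟩ := hv.shift j
  obtain ⟨a, ha⟩ := h.s_suffix (v j)
  obtain ⟨b, hb⟩ := h.q_prefix_two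
  have hocc := hk' 3
  have e : applyM f ((List.range 3).map (shift v j)) = a ++ (s ++ (f 1 ++ q)) ++ b := by
    have : applyM f ((List.range 3).map (shift v j))
        = f (v j) ++ (f (v (j + 1)) ++ f (v (j + 2))) := by
      simp [applyM, shift, List.range_succ, Nat.add_comm]
    rw [this, h1, h2, ← ha, ← hb]
    simp
  rw [e] at hocc
  refine hp.not_occursAt_append (h.ne_nil 1) (h.s_suffix 1) ?_ ?_ hocc.middle
  · simpa [List.append_assoc] using h.q_prefix_one
  · have := h.one_le_sq
    simp only [List.length_append]
    omega

theorem LongOverlaps.eq_zero_of_eq_one (h : LongOverlaps f p q s t) (hp : NoFiveHalves w)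
    (hv : IsImageFrom f v w k) (j : ℕ) (h1 : v (j + 1) = 1) : v (j + 2) = 0 := by
  have := h.not_square hp hv j
  have := h.not_one_two hp hv j h1
  grind

theorem LongOverlaps.exists_eq_zero (h : LongOverlaps f p q s t) (hp : NoFiveHalves w)
    (hv : IsImageFrom f v w k) : ∃ j, v j = 0 := by
  by_contra! hne
  have h1 := h.eq_zero_of_eq_one hp hv 0
  have h2 := h.eq_zero_of_eq_one hp hv 1
  have h3 := h.not_square hp hv 0
  have := hne 1
  have := hne 2
  have := hne 3
  grind

theorem LongOverlaps.exists_preimage (h : LongOverlaps f p q s t) (hp : NoFiveHalves w)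
    (hv : IsImageFrom f v w k) : ∃ v' m, IsImageFrom (mR gam) v' v m := by
  have hstart : ∃ m, v (m + 1) ≠ 0 := by
    by_contra! hall
    exact h.not_square hp hv 0 ((hall 0).trans (hall 1).symm)
  obtain ⟨m, hm⟩ := hstart
  suffices hcut : ∀ k, 1 ≤ k ∧ v k ≠ 0 → ∃ x, OccursAt (mR gam x) v k ∧
      (1 ≤ k + (mR gam x).length ∧ v (k + (mR gam x).length) ≠ 0) by
    obtain ⟨v', hv'⟩ := exists_isImageFrom _ hcut (k := m + 1) ⟨by omega, hm⟩
    exact ⟨v', m + 1, hv'⟩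
  rintro k ⟨hk, hk0⟩
  obtain ⟨j, rfl⟩ := Nat.exists_eq_add_of_le' hk
  have hsq := h.not_square hp hv j
  have hsq' := h.not_square hp hv (j + 1)
  have e0 : mR gam 0 = [1, 0] := rfl
  have e1 : mR gam 1 = [2] := rfl
  have e2 : mR gam 2 = [2, 0] := rfl
  have pair : ∀ x, v (j + 1) = x → v (j + 2) = 0 → OccursAt [x, 0] v (j + 1) := by
    intro x hx h0 i hi
    simp only [List.length_cons, List.length_nil] at hi
    interval_cases i
    exacts [hx.symm, h0.symm]
  by_cases h1 : v (j + 1) = 1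
  · have h0 := h.eq_zero_of_eq_one hp hv j h1
    exact ⟨0, by rw [e0]; exact pair 1 h1 h0, by omega, fun hc => hsq' (h0.trans hc.symm)⟩
  · have h2 : v (j + 1) = 2 := by grind
    by_cases h0 : v (j + 2) = 0
    · exact ⟨2, by rw [e2]; exact pair 2 h2 h0, by omega, fun hc => hsq' (h0.trans hc.symm)⟩
    · refine ⟨1, ?_, by omega, h0⟩
      intro i hi
      rw [e1, List.length_singleton] at hi
      interval_cases i
      exact h2.symm

end LetterPairs

theorem applyM_iterate (f g : Sigma3 → Word) (n : ℕ) (u : Word) :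
    applyM ((fun (F : Sigma3 → Word) x => applyM F (g x))^[n] f) u
      = applyM f ((applyM g)^[n] u) := by
  induction n generalizing u with
  | zero => rfl
  | succ n ih => rw [Function.iterate_succ_apply', ← applyM_applyM, ih, Function.iterate_succ_apply]

theorem reverse_iterate_applyM (f : Sigma3 → Word) (n : ℕ) (u : Word) :
    ((applyM f)^[n] u).reverse = (applyM (mR f))^[n] u.reverse := by
  induction n generalizing u with
  | zero => rfl
  | succ n ih => rw [Function.iterate_succ_apply, ih, reverse_applyM, Function.iterate_succ_apply]

theorem LongOverlaps.isFactor_iterate {f : Sigma3 → Word} {p q s t : Word} {v w : InfWord} {k : ℕ}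
    (h : LongOverlaps f p q s t) (hp : NoFiveHalves w) (hv : IsImageFrom f v w k) (n : ℕ) :
    IsFactor (applyM f ((applyM (mR gam))^[n] [0])) w := by
  have key : ∃ p q s t v k,
      LongOverlaps ((fun (F : Sigma3 → Word) x => applyM F (mR gam x))^[n] f) p q s t ∧
      IsImageFrom ((fun (F : Sigma3 → Word) x => applyM F (mR gam x))^[n] f) v w k := by
    induction n with
    | zero => exact ⟨p, q, s, t, v, k, h, hv⟩
    | succ n ih =>
      obtain ⟨p, q, s, t, v, k, h, hv⟩ := ih
      obtain ⟨v', m, hv'⟩ := h.exists_preimage hp hv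
      obtain ⟨k', hk'⟩ := hv.comp hv'
      rw [Function.iterate_succ_apply']
      exact ⟨_, _, _, _, v', k', h.comp, hk'⟩
  obtain ⟨p, q, s, t, v, k, h, hv⟩ := key
  obtain ⟨j, hj⟩ := h.exists_eq_zero hp hv
  obtain ⟨k', hk'⟩ := hv.shift j
  have hocc := hk' 1
  have e : (List.range 1).map (shift v j) = [0] := by simp [shift, hj]
  rw [e, applyM_iterate] at hocc
  exact hocc.isFactor

theorem iterate_applyM_append (f : Sigma3 → Word) (n : ℕ) (u v : Word) :
    (applyM f)^[n] (u ++ v) = (applyM f)^[n] u ++ (applyM f)^[n] v := by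
  induction n generalizing u v with
  | zero => rfl
  | succ n ih => simp only [Function.iterate_succ_apply, applyM_append, ih]

theorem gam_ne_nil (x : Sigma3) : gam x ≠ [] := by
  fin_cases x <;> simp [gam]

theorem iterate_gam_succ (n : ℕ) :
    (applyM gam)^[n + 1] [0] = (applyM gam)^[n] [0] ++ (applyM gam)^[n] [1] := by
  rw [Function.iterate_succ_apply, ← iterate_applyM_append]
  rfl

theorem iterate_gam_isPrefix {m n : ℕ} (h : m ≤ n) :
    (applyM gam)^[m] [0] <+: (applyM gam)^[n] [0] := by
  induction n, h using Nat.le_induction with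
  | base => exact List.prefix_rfl
  | succ n _ ih =>
    rw [iterate_gam_succ]
    exact ih.trans (List.prefix_append _ _)

theorem lt_length_iterate_gam (n : ℕ) : n < ((applyM gam)^[n] [0]).length := by
  induction n with
  | zero => simp
  | succ n ih =>
    have : ∀ m, 0 < ((applyM gam)^[m] [1]).length := by
      intro m
      induction m with
      | zero => simp
      | succ m ih =>
        rw [Function.iterate_succ_apply']
        exact ih.trans_le (length_le_length_applyM gam_ne_nil _)
    have := this n
    rw [iterate_gam_succ, List.length_append]
    omega

theorem List.IsPrefix.getD_eq {u v : Word} (h : u <+: v) {i : ℕ} (hi : i < u.length) :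
    u.getD i 0 = v.getD i 0 := by
  rw [List.getD_eq_getElem _ _ hi, List.getD_eq_getElem _ _ (hi.trans_le h.length_le),
    h.getElem hi]

theorem occursAt_G (n : ℕ) : OccursAt ((applyM gam)^[n] [0]) G 0 := by
  intro i hi
  rw [Nat.zero_add, G, ← List.getD_eq_getElem _ 0 hi]
  rcases Nat.le_total n (i + 1) with h | h
  · exact (iterate_gam_isPrefix h).getD_eq hi
  · exact ((iterate_gam_isPrefix h).getD_eq
      ((Nat.lt_succ_self i).trans (lt_length_iterate_gam _))).symm

theorem imPrefix_isPrefix (f : Sigma3 → Word) (v : InfWord) {m n : ℕ} (h : m ≤ n) :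
    imPrefix f v m <+: imPrefix f v n := by
  induction n, h using Nat.le_induction with
  | base => exact List.prefix_rfl
  | succ n _ ih =>
    refine ih.trans ?_
    rw [imPrefix, imPrefix, applyM_range_succ]
    exact List.prefix_append _ _

theorem le_length_imPrefix {f : Sigma3 → Word} (hf : ∀ x, f x ≠ []) (v : InfWord) (n : ℕ) :
    n ≤ (imPrefix f v n).length := by
  simpa [imPrefix] using length_le_length_applyM hf ((List.range n).map v)

theorem occursAt_applyMInf {f : Sigma3 → Word} (hf : ∀ x, f x ≠ []) (v : InfWord) (n : ℕ) :
    OccursAt (imPrefix f v n) (applyMInf f v) 0 := by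
  intro i hi
  rw [Nat.zero_add, applyMInf, ← List.getD_eq_getElem _ 0 hi]
  rcases Nat.le_total n (i + 1) with h | h
  · exact (imPrefix_isPrefix f v h).getD_eq hi
  · exact ((imPrefix_isPrefix f v h).getD_eq (le_length_imPrefix hf v _)).symm

theorem IsFactor.infix_image_gam {f : Sigma3 → Word} (hf : ∀ x, f x ≠ []) {u : Word}
    (hu : IsFactor u (applyMInf f G)) :
    ∃ n, u <:+: applyM f ((applyM gam)^[n] [0]) := by
  obtain ⟨i, hi⟩ := hu
  set n := i + u.length
  set N := ((applyM gam)^[n] [0]).length with hN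
  have hG : (List.range N).map G = (applyM gam)^[n] [0] := by
    refine List.ext_getElem (by simp [hN]) fun j h₁ h₂ => ?_
    simpa using (occursAt_G n j h₂).symm
  have hX : imPrefix f G N = applyM f ((applyM gam)^[n] [0]) := by rw [imPrefix, hG]
  have hlen : n < (imPrefix f G N).length :=
    (lt_length_iterate_gam n).trans_le (le_length_imPrefix hf G N)
  refine ⟨n, ?_⟩
  rw [← hX]
  have hu' : u = ((imPrefix f G N).drop i).take u.length := by
    refine List.ext_getElem (by simp; omega) fun j h₁ h₂ => ?_
    rw [List.getElem_of_eq hi h₁, List.getElem_take, List.getElem_drop,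
      occursAt_applyMInf hf G N _ (by omega)]
    simp
  rw [hu']
  exact (List.take_prefix _ _).isInfix.trans (List.drop_suffix _ _).isInfix

theorem longOverlaps_base :
    LongOverlaps ![[0, 2, 0, 0, 2, 0, 1], [0, 0, 2, 0, 1], [0, 0, 2, 0, 0, 2, 0, 1]]
      [0] [0, 0, 2, 0] [0, 0, 2, 0, 1] [0, 2, 0, 0, 2, 0, 1] := by
  constructor <;> decide

section Avoidance

variable {w : InfWord}

theorem NoFiveHalves.not_cube (hp : NoFiveHalves w) {k : ℕ} (h1 : w k = w (k + 1))
    (h2 : w (k + 1) = w (k + 2)) : False := by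
  refine hp.not_periodic (k := k) (p := 1) (n := 3) (by omega) (by omega) fun i hi => ?_
  have : i < 2 := by omega
  interval_cases i
  exacts [h1, h2]

theorem NoFiveHalves.not_period_two (hp : NoFiveHalves w) {k : ℕ} (h1 : w k = w (k + 2))
    (h2 : w (k + 1) = w (k + 3)) (h3 : w (k + 2) = w (k + 4)) : False := by
  refine hp.not_periodic (k := k) (p := 2) (n := 5) (by omega) (by omega) fun i hi => ?_
  have : i < 3 := by omega
  interval_cases i
  exacts [h1, h2, h3]

theorem NoFiveHalves.not_period_three (hp : NoFiveHalves w) {k : ℕ} (h1 : w k = w (k + 3))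
    (h2 : w (k + 1) = w (k + 4)) (h3 : w (k + 2) = w (k + 5)) (h4 : w (k + 3) = w (k + 6))
    (h5 : w (k + 4) = w (k + 7)) : False := by
  refine hp.not_periodic (k := k) (p := 3) (n := 8) (by omega) (by omega) fun i hi => ?_
  have : i < 5 := by omega
  interval_cases i
  exacts [h1, h2, h3, h4, h5]

theorem isFactor_pair (k : ℕ) : IsFactor [w k, w (k + 1)] w :=
  ⟨k, by simp [List.range_succ]⟩

theorem exists_eq_one (hp : NoFiveHalves w) (h3 : ¬ IsFactor [2, 2] w) (m : ℕ) :
    ∃ k, m ≤ k ∧ w k = 1 := by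
  by_contra! hne
  have h02 : ∀ k, m ≤ k → w k = 0 ∨ w k = 2 := fun k hk => by
    have := hne k hk
    grind
  have h20 : ∀ k, m ≤ k → w k = 2 → w (k + 1) = 0 := fun k hk h2 => by
    refine (h02 (k + 1) (by omega)).resolve_right fun h => h3 ?_
    have := isFactor_pair (w := w) k
    rwa [h2, h] at this
  have hstep : ∀ k, m + 1 ≤ k → w k = 2 → w (k + 1) = 0 ∧ w (k + 2) = 0 ∧ w (k + 3) = 2 := by
    intro k hk h2
    obtain ⟨j, rfl⟩ := Nat.exists_eq_add_of_le' (Nat.le_of_add_left_le hk)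
    have e1 := h20 (j + 1) (by omega) h2
    have e0 : w j = 0 := (h02 j (by omega)).resolve_right fun h => by
      have := h20 j (by omega) h
      simp [this] at h2
    have e2 : w (j + 3) = 0 := (h02 (j + 3) (by omega)).resolve_right fun h => by
      have := h20 (j + 3) (by omega) h
      exact hp.not_period_two (e0.trans e1.symm) (h2.trans h.symm) (e1.trans this.symm)
    have e3 : w (j + 4) = 2 := (h02 (j + 4) (by omega)).resolve_left fun h =>
      hp.not_cube (k := j + 2) (e1.trans e2.symm) (e2.trans h.symm)
    exact ⟨e1, e2, e3⟩
  have hex : ∃ k, m + 1 ≤ k ∧ w k = 2 := by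
    by_contra! hne2
    have e0 := (h02 (m + 1) (by omega)).resolve_right (hne2 _ (by omega))
    have e1 := (h02 (m + 2) (by omega)).resolve_right (hne2 _ (by omega))
    have e2 := (h02 (m + 3) (by omega)).resolve_right (hne2 _ (by omega))
    exact hp.not_cube (k := m + 1) (e0.trans e1.symm) (e1.trans e2.symm)
  obtain ⟨k, hk, h2⟩ := hex
  obtain ⟨a1, a2, a3⟩ := hstep k hk h2
  obtain ⟨b1, b2, b3⟩ := hstep (k + 3) (by omega) a3
  obtain ⟨c1, -, -⟩ := hstep (k + 6) (by omega) b3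
  exact hp.not_period_three (h2.trans a3.symm) (a1.trans b1.symm) (a2.trans b2.symm)
    (a3.trans b3.symm) (b1.trans c1.symm)

theorem exists_isImageFrom_base (hp : NoFiveHalves w)
    (h0 : ¬ IsFactor [1, 1] w) (h1 : ¬ IsFactor [1, 2] w) (h2 : ¬ IsFactor [2, 1] w)
    (h3 : ¬ IsFactor [2, 2] w) (h4 : ¬ IsFactor [0, 0, 1] w) (h5 : ¬ IsFactor [1, 0, 2, 0, 1] w) :
    ∃ v k, IsImageFrom
      ![[0, 2, 0, 0, 2, 0, 1], [0, 0, 2, 0, 1], [0, 0, 2, 0, 0, 2, 0, 1]] v w k := by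
  have cases3 : ∀ x : Sigma3, x = 0 ∨ x = 1 ∨ x = 2 := by decide
  have hzero : ∀ k, w k ≠ 0 → w (k + 1) = 0 := by
    intro k hk
    have hpair := isFactor_pair (w := w) k
    rcases cases3 (w k) with e | e | e <;> rcases cases3 (w (k + 1)) with e' | e' | e' <;>
      rw [e, e'] at hpair <;> first | exact e' | exact absurd e hk | contradiction
  have h001 : ∀ k, w k = 0 → w (k + 1) = 0 → w (k + 2) = 2 := by
    intro k a b
    rcases cases3 (w (k + 2)) with e | e | e
    · exact (hp.not_cube (a.trans b.symm) (b.trans e.symm)).elim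
    · exact absurd ⟨k, by simp [List.range_succ, a, b, e]⟩ h4
    · exact e
  have h0202 : ∀ k, w k = 0 → w (k + 1) = 2 → w (k + 3) ≠ 2 := by
    intro k a b d
    have c := hzero (k + 1) (by simp [b])
    have e := hzero (k + 3) (by simp [d])
    exact hp.not_period_two (a.trans c.symm) (b.trans d.symm) (c.trans e.symm)
  obtain ⟨m, hm, hm1⟩ := exists_eq_one hp h3 1
  obtain ⟨m, rfl⟩ := Nat.exists_eq_add_of_le' hm
  suffices hcut : ∀ k, (∃ j, k = j + 2 ∧ w (j + 1) = 1) → ∃ x, OccursAt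
      ((![[0, 2, 0, 0, 2, 0, 1], [0, 0, 2, 0, 1], [0, 0, 2, 0, 0, 2, 0, 1]] : Sigma3 → Word) x) w k ∧
      ∃ j, k + ((![[0, 2, 0, 0, 2, 0, 1], [0, 0, 2, 0, 1], [0, 0, 2, 0, 0, 2, 0, 1]] :
        Sigma3 → Word) x).length = j + 2 ∧ w (j + 1) = 1 by
    obtain ⟨v, hv⟩ := exists_isImageFrom _ hcut (k := m + 2) ⟨m, rfl, hm1⟩
    exact ⟨v, _, hv⟩
  rintro _ ⟨j, rfl, b1⟩
  have b0 : w j = 0 := by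
    by_contra h
    simp [hzero j h] at b1
  have b2 := hzero (j + 1) (by simp [b1])
  rcases cases3 (w (j + 3)) with b3 | b3 | b3
  · have b4 := h001 (j + 2) b2 b3
    have b5 := hzero (j + 4) (by simp [b4])
    rcases cases3 (w (j + 6)) with b6 | b6 | b6
    · have b7 := h001 (j + 5) b5 b6
      have b8 := hzero (j + 7) (by simp [b7])
      rcases cases3 (w (j + 9)) with b9 | b9 | b9
      · exact (hp.not_period_three (k := j + 2) (b2.trans b5.symm) (b3.trans b6.symm)
          (b4.trans b7.symm) (b5.trans b8.symm) (b6.trans b9.symm)).elim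
      · refine ⟨2, ?_, j + 8, rfl, b9⟩
        intro i hi
        change i < 8 at hi
        interval_cases i
        exacts [b2.symm, b3.symm, b4.symm, b5.symm, b6.symm, b7.symm, b8.symm, b9.symm]
      · exact absurd b9 (h0202 (j + 6) b6 b7)
    · refine ⟨1, ?_, j + 5, rfl, b6⟩
      intro i hi
      change i < 5 at hi
      interval_cases i
      exacts [b2.symm, b3.symm, b4.symm, b5.symm, b6.symm]
    · exact absurd b6 (h0202 (j + 3) b3 b4)
  · have b4 := hzero (j + 3) (by simp [b3])
    exact (hp.not_period_two (b0.trans b2.symm) (b1.trans b3.symm) (b2.trans b4.symm)).elim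
  · have b4 := hzero (j + 3) (by simp [b3])
    rcases cases3 (w (j + 5)) with b5 | b5 | b5
    · have b6 := h001 (j + 4) b4 b5
      have b7 := hzero (j + 6) (by simp [b6])
      rcases cases3 (w (j + 8)) with b8 | b8 | b8
      · have b9 := h001 (j + 7) b7 b8
        exact (hp.not_period_three (k := j + 2) (b2.trans b5.symm) (b3.trans b6.symm)
          (b4.trans b7.symm) (b5.trans b8.symm) (b6.trans b9.symm)).elim
      · refine ⟨0, ?_, j + 7, rfl, b8⟩
        intro i hi
        change i < 7 at hi
        interval_cases i
        exacts [b2.symm, b3.symm, b4.symm, b5.symm, b6.symm, b7.symm, b8.symm]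
      · exact absurd b8 (h0202 (j + 5) b5 b6)
    · exact absurd ⟨j + 1, by simp [List.range_succ, b1, b2, b3, b4, b5]⟩ h5
    · exact absurd b5 (h0202 (j + 2) b2 b3)

end Avoidance

/-- Case analysis step: an eligible word omitting the listed factors satisfies the
stated inclusion for the morphism `h₁`. -/
theorem stmt13 (w : InfWord) (hp : NoFiveHalves w)
    (hc : ∀ n : ℕ, complexity w n = 2 * n + 1)
    (h0 : ¬ IsFactor [1, 1] w)
    (h1 : ¬ IsFactor [1, 2] w)
    (h2 : ¬ IsFactor [2, 1] w)
    (h3 : ¬ IsFactor [2, 2] w)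
    (h4 : ¬ IsFactor [0, 0, 1] w)
    (h5 : ¬ IsFactor [1, 0, 2, 0, 1] w) :
    Lang (applyMInf (mR ![[0, 2, 0, 0, 2, 0, 1], [0, 0, 2, 0, 1], [0, 0, 2, 0, 0, 2, 0, 1]]) G) ⊆ List.reverse '' Lang w := by
  intro u hu
  obtain ⟨v, k, hv⟩ := exists_isImageFrom_base hp h0 h1 h2 h3 h4 h5
  obtain ⟨n, s, t, hst⟩ := IsFactor.infix_image_gam (by decide) hu
  have hfac := longOverlaps_base.isFactor_iterate hp hv n
  have hrev := congrArg List.reverse hst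
  rw [reverse_applyM, reverse_iterate_applyM] at hrev
  refine ⟨u.reverse, IsFactor.of_append (s := t.reverse) (t := s.reverse) ?_, List.reverse_reverse u⟩
  convert hfac using 1
  simpa [mR_mR] using hrev
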